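/- arXiv:math/0408360 — 4 statements merged into one kernel-verified Lean document; each statement's English description precedes it below -/
import Mathlib

section
/- Let q ≥ 4 be a real number and n ≥ 1 an integer, and let r_{n,1} < r_{n,2} < ⋯ < r_{n,n} be the n distinct positive roots of F_{q,≤n}(x). For 1 ≤ j ≤ n set k = n+1−j and define c₁ = 1 − 2q^{−1} and c_k = 1 + (−1)^k·4q^{−k(k+1)/2} for k > 1. Then r_{n,j}·q^{−j} lies strictly between 1 and c_k (i.e., min(1, c_k) < r_{n,j}q^{−j} < max(1, c_k)). -/
/-- The `q`-Pochhammer symbol `(q;q)_k = ∏_{j=1}^k (1 - q^j)`. -/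
def poch (q : ℝ) (k : ℕ) : ℝ := ∏ j ∈ Finset.range k, (1 - q ^ (j + 1))

/-- The constant `c_k`: `c₁ = 1 - 2/q` and `c_k = 1 + (-1)^k · 4 · q^{-k(k+1)/2}`
for `k > 1`. -/
noncomputable def ck (q : ℝ) (k : ℕ) : ℝ :=
  if k = 1 then 1 - 2 / q else 1 + (-1) ^ k * 4 / q ^ (k * (k + 1) / 2)

/-- The truncated series `F_{q,≤n}`. -/
noncomputable def truncF (q : ℝ) (n : ℕ) (x : ℝ) : ℝ :=
  ∑ m ∈ Finset.range (n + 1), x ^ m / poch q m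

/-- The finite product `∏_{l=1}^m (1 - a q^{-l})`. -/
noncomputable def eulerProd (q a : ℝ) (m : ℕ) : ℝ :=
  ∏ l ∈ Finset.range m, (1 - a / q ^ (l + 1))

lemma poch_succ (q : ℝ) (n : ℕ) : poch q (n + 1) = poch q n * (1 - q ^ (n + 1)) :=
  Finset.prod_range_succ _ _

lemma poch_ne_zero {q : ℝ} (hq : 1 < q) (n : ℕ) : poch q n ≠ 0 :=
  Finset.prod_ne_zero_iff.2 fun j _ => by
    have := one_lt_pow₀ hq j.succ_ne_zero
    exact (sub_neg.2 this).ne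

/-- The functional equation `F_{≤n}(qx) = (1 - x) F_{≤n}(x) + x^{n+1}/(q;q)_n`. -/
lemma truncF_mul {q : ℝ} (hq : 1 < q) (n : ℕ) (x : ℝ) :
    truncF q n (q * x) = (1 - x) * truncF q n x + x ^ (n + 1) / poch q n := by
  induction n with
  | zero => simp [truncF, poch]
  | succ n ih =>
    have h1 := poch_ne_zero hq n
    have h2 : 1 - q ^ (n + 1) ≠ 0 := (sub_neg.2 (one_lt_pow₀ hq n.succ_ne_zero)).ne
    have e : ∀ y, truncF q (n + 1) y = truncF q n y + y ^ (n + 1) / poch q (n + 1) :=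
      fun y => Finset.sum_range_succ _ _
    rw [e, e, ih, poch_succ, mul_pow]
    field_simp
    ring

lemma exists_truncF_mul_pow {q c : ℝ} (hq : 1 < q) (hc : 0 < c) (hcq : 1 ≤ c * q) (hc' : c ≤ q)
    (n j : ℕ) (hj : j ≤ n) :
    ∃ R, 0 < R ∧ R ≤ (c * q ^ j) ^ (n + 1) ∧ poch q n * truncF q n (c * q ^ (j + 1)) =
      R + (1 - c) * (∏ l ∈ Finset.range j, (1 - c * q ^ (l + 1))) * (poch q n * truncF q n c) := by
  have hp := poch_ne_zero hq n
  have hq0 : 0 < q := by linarith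
  induction j with
  | zero =>
    refine ⟨c ^ (n + 1), by positivity, by simp, ?_⟩
    rw [show c * q ^ (0 + 1) = q * c by ring, truncF_mul hq]
    field_simp
    simp
    ring
  | succ j ih =>
    obtain ⟨R, h0, h1, h2⟩ := ih (by omega)
    have hge : 1 ≤ c * q ^ (j + 1) := by
      have : 1 ≤ q ^ j := one_le_pow₀ hq.le
      rw [pow_succ]
      nlinarith
    have hle : c * q ^ (j + 1) ≤ q ^ (n + 1) := by
      calc c * q ^ (j + 1) ≤ q * q ^ (j + 1) := by gcongr
        _ = q ^ (j + 2) := by ring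
        _ ≤ q ^ (n + 1) := pow_le_pow_right₀ hq.le (by omega)
    have e : (c * q ^ (j + 1)) ^ (n + 1) = (c * q ^ j) ^ (n + 1) * q ^ (n + 1) := by
      rw [← mul_pow]; ring
    refine ⟨(c * q ^ (j + 1)) ^ (n + 1) - (c * q ^ (j + 1) - 1) * R, ?_, ?_, ?_⟩
    · rw [e]
      have := mul_le_mul_of_nonneg_right hle h0.le
      have := mul_le_mul_of_nonneg_right h1 (by positivity : 0 ≤ q ^ (n + 1))
      nlinarith
    · have := mul_nonneg (sub_nonneg.2 hge) h0.le
      linarith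
    · rw [show c * q ^ (j + 1 + 1) = q * (c * q ^ (j + 1)) by ring, truncF_mul hq,
        Finset.prod_range_succ, mul_add, mul_div_cancel₀ _ hp]
      linear_combination (1 - c * q ^ (j + 1)) * h2

lemma alternating_sum_mem {b : ℕ → ℝ} (hb : Antitone b) (h0 : ∀ m, 0 ≤ b m) (N : ℕ) :
    0 ≤ ∑ m ∈ Finset.range N, (-1) ^ m * b m ∧ ∑ m ∈ Finset.range N, (-1) ^ m * b m ≤ b 0 := by
  induction N generalizing b with
  | zero => simpa using h0 0
  | succ N ih =>
    have := ih (b := fun m => b (m + 1)) (fun x y h => hb (by omega)) (fun m => h0 _)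
    have hs : ∑ m ∈ Finset.range (N + 1), (-1) ^ m * b m
        = b 0 - ∑ m ∈ Finset.range N, (-1) ^ m * b (m + 1) := by
      rw [Finset.sum_range_succ', sub_eq_add_neg, ← Finset.sum_neg_distrib, add_comm]
      simp [pow_succ]
    have h01 := hb (Nat.zero_le 1)
    simp only [zero_add] at this
    rw [hs]
    constructor <;> linarith [this.1, this.2]

lemma prod_one_sub (g : ℕ → ℝ) (n : ℕ) :
    ∏ l ∈ Finset.range n, (1 - g l) = (-1) ^ n * ∏ l ∈ Finset.range n, (g l - 1) := by
  induction n with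
  | zero => simp
  | succ n ih => rw [Finset.prod_range_succ, Finset.prod_range_succ, ih]; ring

lemma le_truncF {q c : ℝ} (hq : 1 < q) (hc : 0 ≤ c) (hcq : c ≤ q - 1) (n : ℕ) :
    1 - c / (q - 1) ≤ truncF q n c := by
  have hB : ∀ m, 0 < ∏ l ∈ Finset.range m, (q ^ (l + 1) - 1) := fun m =>
    Finset.prod_pos fun l _ => sub_pos.2 (one_lt_pow₀ hq l.succ_ne_zero)
  set b : ℕ → ℝ := fun m => c ^ (m + 1) / ∏ l ∈ Finset.range (m + 1), (q ^ (l + 1) - 1) with hb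
  have h0 : ∀ m, 0 ≤ b m := fun m => div_nonneg (by positivity) (hB _).le
  have hanti : Antitone b := by
    refine antitone_nat_of_succ_le fun m => ?_
    have hx : 0 < q ^ (m + 1 + 1) - 1 := sub_pos.2 (one_lt_pow₀ hq (by omega))
    have hle : c ≤ q ^ (m + 1 + 1) - 1 := by
      have := le_self_pow₀ hq.le (show m + 1 + 1 ≠ 0 by omega)
      linarith
    have : b (m + 1) = b m * (c / (q ^ (m + 1 + 1) - 1)) := by
      simp only [hb]
      rw [Finset.prod_range_succ _ (m + 1), pow_succ c (m + 1), mul_div_mul_comm]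
    rw [this]
    exact mul_le_of_le_one_right (h0 m) ((div_le_one hx).2 hle)
  have hs : truncF q n c = 1 - ∑ m ∈ Finset.range n, (-1) ^ m * b m := by
    rw [truncF, Finset.sum_range_succ', sub_eq_add_neg, ← Finset.sum_neg_distrib, add_comm]
    congr 1
    · simp [poch]
    · refine Finset.sum_congr rfl fun m _ => ?_
      have := (hB (m + 1)).ne'
      simp only [hb]
      rw [poch, prod_one_sub]
      rcases neg_one_pow_eq_or ℝ m with h | h <;> simp [pow_succ, h, div_neg]
  have := (alternating_sum_mem hanti h0 n).2
  have e : b 0 = c / (q - 1) := by simp [hb]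
  rw [hs]
  linarith

lemma le_eulerProd {q a : ℝ} (hq : 1 < q) (ha : 0 ≤ a) (haq : a ≤ q) (m : ℕ) :
    1 - a / (q - 1) ≤ eulerProd q a m := by
  have hq1 : 0 < q - 1 := by linarith
  have key : 1 - a / (q - 1) * (1 - 1 / q ^ m) ≤ eulerProd q a m ∧
      0 ≤ eulerProd q a m ∧ eulerProd q a m ≤ 1 := by
    induction m with
    | zero => simp [eulerProd]
    | succ m ih =>
      obtain ⟨h1, h2, h3⟩ := ih
      have hpos : 0 < q ^ (m + 1) := by positivity
      have hu0 : 0 ≤ a / q ^ (m + 1) := by positivity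
      have hu1 : a / q ^ (m + 1) ≤ 1 :=
        (div_le_one hpos).2 (haq.trans (le_self_pow₀ hq.le m.succ_ne_zero))
      have e : eulerProd q a (m + 1) = eulerProd q a m * (1 - a / q ^ (m + 1)) :=
        Finset.prod_range_succ _ _
      have es : a / (q - 1) * (1 - 1 / q ^ (m + 1))
          = a / (q - 1) * (1 - 1 / q ^ m) + a / q ^ (m + 1) := by
        field_simp
        ring
      rw [e, es]
      exact ⟨by nlinarith, by nlinarith, by nlinarith⟩
  have : 0 ≤ a / (q - 1) * (1 / q ^ m) := by positivity
  linarith [key.1]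

lemma le_eulerProd_one {q : ℝ} (hq : 4 ≤ q) (m : ℕ) : 11 / 16 ≤ eulerProd q 1 m := by
  have ht : 1 / q ≤ 1 / 4 := by gcongr
  have ht0 : 0 < 1 / q := by positivity
  rcases m with _ | m
  · norm_num [eulerProd]
  have key : 1 - 1 / q - (1 / q) ^ 2 + (1 / q) ^ (m + 2) ≤ eulerProd q 1 (m + 1) := by
    induction m with
    | zero => simp [eulerProd]
    | succ m ih =>
      have e : eulerProd q 1 (m + 1 + 1)
          = eulerProd q 1 (m + 1) * (1 - (1 / q) ^ (m + 2)) := by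
        rw [eulerProd, Finset.prod_range_succ, one_div_pow]; rfl
      have hle : (1 / q) ^ (m + 2) ≤ (1 / q) ^ 2 :=
        pow_le_pow_of_le_one ht0.le (by linarith) (by omega)
      have hp : 0 < (1 / q) ^ (m + 2) := by positivity
      rw [e, show (1 / q) ^ (m + 1 + 2) = (1 / q) ^ (m + 2) * (1 / q) by ring]
      have := mul_le_mul_of_nonneg_right ih (show 0 ≤ 1 - (1 / q) ^ (m + 2) by nlinarith)
      nlinarith
  have : 0 < (1 / q) ^ (m + 2) := by positivity
  nlinarith

lemma eulerProd_anti {q a b : ℝ} (hq : 0 < q) (hbq : ∀ l : ℕ, b ≤ q ^ (l + 1)) (hab : a ≤ b)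
    (m : ℕ) : eulerProd q b m ≤ eulerProd q a m := by
  refine Finset.prod_le_prod (fun l _ => sub_nonneg.2 ((div_le_one (by positivity)).2 (hbq l)))
    fun l _ => ?_
  gcongr

lemma prod_mul_pow_sub_one {q c : ℝ} (hq : q ≠ 0) (hc : c ≠ 0) (m : ℕ) :
    ∏ l ∈ Finset.range m, (c * q ^ (l + 1) - 1)
      = c ^ m * q ^ (m * (m + 1) / 2) * eulerProd q (1 / c) m := by
  induction m with
  | zero => simp [eulerProd]
  | succ m ih =>
    have h : (m + 1) * (m + 1 + 1) / 2 = m * (m + 1) / 2 + (m + 1) := by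
      rw [show (m + 1) * (m + 1 + 1) = m * (m + 1) + (m + 1) * 2 by ring,
        Nat.add_mul_div_right _ _ two_pos]
    have e : eulerProd q (1 / c) (m + 1) = eulerProd q (1 / c) m * (1 - 1 / c / q ^ (m + 1)) :=
      Finset.prod_range_succ _ _
    have e' : c * q ^ (m + 1) - 1 = c * q ^ (m + 1) * (1 - 1 / c / q ^ (m + 1)) := by
      field_simp
    rw [Finset.prod_range_succ, ih, h, e, e', pow_add q (m * (m + 1) / 2), pow_succ c]
    ring

lemma triangle_add (i k : ℕ) : i * (i + 1) / 2 + (i + k) * (i + k + 1) / 2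
    = i * (i + k + 1) + k * (k + 1) / 2 := by
  obtain ⟨a, ha⟩ := Nat.even_mul_succ_self i
  obtain ⟨b, hb⟩ := Nat.even_mul_succ_self (i + k)
  obtain ⟨d, hd⟩ := Nat.even_mul_succ_self k
  have e : i * (i + 1) + (i + k) * (i + k + 1) = 2 * (i * (i + k + 1)) + k * (k + 1) := by ring
  omega

lemma poch_mul_truncF_neg {q c d : ℝ} (hq : 4 ≤ q) (hc : 1 / 2 ≤ c) (hc' : c ≤ 2) (i k : ℕ)
    (hd : (-1) ^ k * (1 - c) = -d)
    (h : c ^ (k + 1) < d * q ^ (k * (k + 1) / 2) *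
      (eulerProd q 1 (i + k) * eulerProd q (1 / c) i * truncF q (i + k) c)) :
    poch q (i + k) * truncF q (i + k) (c * q ^ (i + 1)) < 0 := by
  have hq0 : 0 < q := by linarith
  have hc0 : 0 < c := by linarith
  obtain ⟨R, -, hR, e⟩ := exists_truncF_mul_pow (by linarith : 1 < q) hc0 (by nlinarith)
    (by linarith) (i + k) i (by omega)
  have hB : poch q (i + k)
      = (-1) ^ (i + k) * (q ^ ((i + k) * (i + k + 1) / 2) * eulerProd q 1 (i + k)) := by
    have := prod_mul_pow_sub_one hq0.ne' one_ne_zero (i + k)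
    simp only [one_mul, one_pow, div_one] at this
    rw [poch, prod_one_sub, this]
  have hs : (-1 : ℝ) ^ i * (-1) ^ (i + k) = (-1) ^ k := by
    rw [pow_add, ← mul_assoc, ← mul_pow]; norm_num
  have hT : q ^ (i * (i + 1) / 2) * q ^ ((i + k) * (i + k + 1) / 2)
      = q ^ (i * (i + k + 1)) * q ^ (k * (k + 1) / 2) := by
    rw [← pow_add, ← pow_add, triangle_add]
  have hmain : (1 - c) * (∏ l ∈ Finset.range i, (1 - c * q ^ (l + 1))) *
      (poch q (i + k) * truncF q (i + k) c) = -(c ^ i * q ^ (i * (i + k + 1)) *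
      (d * q ^ (k * (k + 1) / 2) *
      (eulerProd q 1 (i + k) * eulerProd q (1 / c) i * truncF q (i + k) c))) := by
    rw [prod_one_sub, prod_mul_pow_sub_one hq0.ne' hc0.ne', hB]
    calc _ = ((-1 : ℝ) ^ i * (-1) ^ (i + k)) * (1 - c) *
          (q ^ (i * (i + 1) / 2) * q ^ ((i + k) * (i + k + 1) / 2)) *
          (c ^ i * (eulerProd q 1 (i + k) * eulerProd q (1 / c) i * truncF q (i + k) c)) := by
            ring
      _ = _ := by rw [hs, hT, hd]; ring
  have hR' : (c * q ^ i) ^ (i + k + 1) = c ^ i * q ^ (i * (i + k + 1)) * c ^ (k + 1) := by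
    rw [mul_pow, ← pow_mul]; ring
  rw [e, hmain]
  have := mul_lt_mul_of_pos_left h (show 0 < c ^ i * q ^ (i * (i + k + 1)) by positivity)
  linarith

lemma sixty_eight_mul_le (k : ℕ) (hk : 2 ≤ k) : (68 * (k + 1) : ℝ) ≤ 3 * 4 ^ (k + 1) + 12 := by
  induction k, hk using Nat.le_induction with
  | base => norm_num
  | succ k hk ih =>
    push_cast
    have : (2 : ℝ) ≤ k := by exact_mod_cast hk
    rw [pow_succ]
    nlinarith

lemma four_pow_le {q : ℝ} (hq : 4 ≤ q) {m e : ℕ} (h : m ≤ e) : (4 : ℝ) ^ m ≤ q ^ e :=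
  (pow_le_pow_right₀ (by norm_num) h).trans (pow_le_pow_left₀ (by norm_num) hq e)

lemma one_add_pow_succ_le {q : ℝ} (hq : 4 ≤ q) {k : ℕ} (hk : 2 ≤ k) :
    (1 + 4 / q ^ (k * (k + 1) / 2)) ^ (k + 1) ≤ 17 / 14 := by
  have hQ : (4 : ℝ) ^ (k + 1) ≤ q ^ (k * (k + 1) / 2) := four_pow_le hq
    ((Nat.le_div_iff_mul_le two_pos).2 (by nlinarith))
  set Q := q ^ (k * (k + 1) / 2)
  have h68 := sixty_eight_mul_le k hk
  have hQ0 : 0 < Q := lt_of_lt_of_le (by positivity) hQ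
  have hb := one_add_mul_le_pow (a := -(4 / (Q + 4)))
    (by rw [neg_le_neg_iff, div_le_iff₀ (by linarith)]; linarith) (k + 1)
  have h3 : ((k + 1 : ℕ) : ℝ) * (4 / (Q + 4)) ≤ 3 / 17 := by
    rw [← mul_div_assoc, div_le_iff₀ (by linarith)]
    push_cast
    linarith
  have e : (1 + 4 / Q) * (1 + -(4 / (Q + 4))) = 1 := by field_simp; ring
  have e' : (1 + 4 / Q) ^ (k + 1) * (1 + -(4 / (Q + 4))) ^ (k + 1) = 1 := by
    rw [← mul_pow, e, one_pow]
  have hp : 0 < (1 + 4 / Q) ^ (k + 1) := by positivity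
  nlinarith

lemma ck_one {q : ℝ} : ck q 1 = 1 - 2 / q := by simp [ck]

lemma ck_even {q : ℝ} {k : ℕ} (hk : 2 ≤ k) (he : Even k) :
    ck q k = 1 + 4 / q ^ (k * (k + 1) / 2) := by
  rw [ck, if_neg (by omega), he.neg_one_pow, one_mul]

lemma ck_odd {q : ℝ} {k : ℕ} (hk : 2 ≤ k) (ho : Odd k) :
    ck q k = 1 - 4 / q ^ (k * (k + 1) / 2) := by
  rw [ck, if_neg (by omega), ho.neg_one_pow]
  ring

lemma ck_bounds {q : ℝ} (hq : 4 ≤ q) {k : ℕ} (hk : 1 ≤ k) :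
    1 / 2 ≤ ck q k ∧ ck q k ≤ 17 / 16 := by
  have hq0 : 0 < q := by linarith
  rcases hk.eq_or_lt with rfl | hk
  · rw [ck_one]
    have : 2 / q ≤ 1 / 2 := by rw [div_le_iff₀ hq0]; linarith
    have : 0 < 2 / q := by positivity
    constructor <;> linarith
  · have hQ : (4 : ℝ) ^ 3 ≤ q ^ (k * (k + 1) / 2) := four_pow_le hq
      ((Nat.le_div_iff_mul_le two_pos).2 (by nlinarith))
    have h1 : 4 / q ^ (k * (k + 1) / 2) ≤ 1 / 16 := by
      rw [div_le_iff₀ (by positivity)]; linarith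
    have h0 : 0 < 4 / q ^ (k * (k + 1) / 2) := by positivity
    rcases k.even_or_odd with h | h
    · rw [ck_even hk h]; constructor <;> linarith
    · rw [ck_odd hk h]; constructor <;> linarith

lemma poch_mul_truncF_ck_neg {q : ℝ} (hq : 4 ≤ q) (i : ℕ) {k : ℕ} (hk : 1 ≤ k) :
    poch q (i + k) * truncF q (i + k) (ck q k * q ^ (i + 1)) < 0 := by
  have hq0 : 0 < q := by linarith
  have hq1 : 1 < q := by linarith
  obtain ⟨hc, hc'⟩ := ck_bounds hq hk
  have hF := le_truncF hq1 (by linarith) (by linarith : ck q k ≤ q - 1) (i + k)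
  have hA := le_eulerProd_one hq (i + k)
  have hA' := le_eulerProd hq1 zero_le_one hq1.le (i + k)
  have hcinv : 1 / ck q k ≤ 2 := by rw [div_le_iff₀ (by linarith)]; linarith
  have hP := le_eulerProd hq1 (by positivity : 0 ≤ 1 / ck q k) (by linarith) i
  have hq3 : ∀ a : ℝ, 0 ≤ a → a / (q - 1) ≤ a / 3 := fun a ha => by gcongr; linarith
  rcases hk.eq_or_lt with rfl | hk
  · refine poch_mul_truncF_neg hq hc (by linarith) i 1 (d := 2 / q) (by rw [ck_one]; ring) ?_
    have hAe : 1 - 1 / (q - 1) = (q - 2) / (q - 1) := by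
      field_simp [show q - 1 ≠ 0 by linarith]; ring
    have hPe : 1 - 1 / ck q 1 / (q - 1) = (q ^ 2 - 4 * q + 2) / ((q - 1) * (q - 2)) := by
      rw [ck_one]
      have : q - 1 ≠ 0 := by linarith
      have : q - 2 ≠ 0 := by linarith
      rw [show 1 - 2 / q = (q - 2) / q by field_simp]
      field_simp
      ring
    have hFe : 1 - ck q 1 / (q - 1) = (q ^ 2 - 2 * q + 2) / (q * (q - 1)) := by
      rw [ck_one]
      have : q - 1 ≠ 0 := by linarith
      field_simp
      ring
    have h1 : 0 < q - 1 := by linarith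
    have h2 : 0 < q - 2 := by linarith
    have h3 : 0 < q ^ 2 - 4 * q + 2 := by nlinarith
    have h4 : 0 < q ^ 2 - 2 * q + 2 := by nlinarith
    rw [hAe] at hA'
    rw [hPe] at hP
    rw [hFe] at hF
    have hprod : (q - 2) / (q - 1) * ((q ^ 2 - 4 * q + 2) / ((q - 1) * (q - 2))) *
        ((q ^ 2 - 2 * q + 2) / (q * (q - 1))) ≤
        eulerProd q 1 (i + 1) * eulerProd q (1 / ck q 1) i * truncF q (i + 1) (ck q 1) := by
      have p1 : 0 ≤ (q - 2) / (q - 1) := by positivity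
      have p2 : 0 ≤ (q ^ 2 - 4 * q + 2) / ((q - 1) * (q - 2)) := by positivity
      have p3 : 0 ≤ (q ^ 2 - 2 * q + 2) / (q * (q - 1)) := by positivity
      exact mul_le_mul (mul_le_mul hA' hP p2 (p1.trans hA')) hF p3
        (mul_nonneg (p1.trans hA') (p2.trans hP))
    have hd : 2 / q * q ^ (1 * (1 + 1) / 2) = 2 := by norm_num; field_simp
    rw [hd]
    refine lt_of_lt_of_le ?_ (mul_le_mul_of_nonneg_left hprod zero_le_two)
    have hpoly : (q - 2) ^ 2 * (q - 1) ^ 3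
        < 2 * q * (q ^ 2 - 4 * q + 2) * (q ^ 2 - 2 * q + 2) := by
      obtain ⟨u, hu, rfl⟩ : ∃ u, 0 ≤ u ∧ q = 4 + u := ⟨q - 4, by linarith, by ring⟩
      rw [← sub_pos]
      ring_nf
      positivity
    have hl : ck q 1 ^ (1 + 1) = (q - 2) ^ 2 / q ^ 2 := by
      rw [ck_one, ← div_pow]
      congr 1
      field_simp
    have hr : 2 * ((q - 2) / (q - 1) * ((q ^ 2 - 4 * q + 2) / ((q - 1) * (q - 2))) *
        ((q ^ 2 - 2 * q + 2) / (q * (q - 1)))) =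
        2 * q * (q ^ 2 - 4 * q + 2) * (q ^ 2 - 2 * q + 2) / (q - 1) ^ 3 / q ^ 2 := by
      field_simp
    rw [hl, hr]
    gcongr
    rwa [lt_div_iff₀ (by positivity)]
  · have hQ0 : 0 < q ^ (k * (k + 1) / 2) := by positivity
    have hd : 4 / q ^ (k * (k + 1) / 2) * q ^ (k * (k + 1) / 2) = 4 := by field_simp
    have hF3 := hq3 (ck q k) (by linarith)
    rcases k.even_or_odd with h | h
    · have hce := ck_even (q := q) hk h
      refine poch_mul_truncF_neg hq hc (by linarith) i k (d := 4 / q ^ (k * (k + 1) / 2))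
        (by rw [hce, h.neg_one_pow]; ring) ?_
      rw [hd]
      have hpow := one_add_pow_succ_le hq hk
      rw [← hce] at hpow
      have hc1 : 1 ≤ ck q k := by
        rw [hce]
        have : 0 < 4 / q ^ (k * (k + 1) / 2) := by positivity
        linarith
      have hP' : 11 / 16 ≤ eulerProd q (1 / ck q k) i :=
        (le_eulerProd_one hq i).trans (eulerProd_anti hq0 (fun l => one_le_pow₀ hq1.le)
          ((div_le_one (by linarith)).2 hc1) i)
      have hF' : 31 / 48 ≤ truncF q (i + k) (ck q k) := by linarith
      have hprod : (11 / 16 * (11 / 16) * (31 / 48) : ℝ) ≤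
          eulerProd q 1 (i + k) * eulerProd q (1 / ck q k) i * truncF q (i + k) (ck q k) := by
        gcongr
      linarith
    · have hce := ck_odd (q := q) hk h
      refine poch_mul_truncF_neg hq hc (by linarith) i k (d := 4 / q ^ (k * (k + 1) / 2))
        (by rw [hce, h.neg_one_pow]; ring) ?_
      rw [hd]
      have hk3 : 3 ≤ k := by
        rcases h with ⟨m, rfl⟩; omega
      have hQ : (4 : ℝ) ^ 3 ≤ q ^ (k * (k + 1) / 2) := four_pow_le hq
        ((Nat.le_div_iff_mul_le two_pos).2 (by nlinarith))
      have hx : 4 / q ^ (k * (k + 1) / 2) ≤ 1 / 16 := by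
        rw [div_le_iff₀ hQ0]; linarith
      have hx0 : 0 < 4 / q ^ (k * (k + 1) / 2) := by positivity
      have hpow : ck q k ^ (k + 1) ≤ 1 := pow_le_one₀ (by linarith) (by rw [hce]; linarith)
      have hinv : 1 / ck q k ≤ 9 / 8 := by
        rw [div_le_iff₀ (by linarith), hce]; linarith
      have hP' : 5 / 8 ≤ eulerProd q (1 / ck q k) i := by
        have := hq3 (1 / ck q k) (by positivity)
        linarith
      have hF' : 2 / 3 ≤ truncF q (i + k) (ck q k) := by linarith
      have hprod : (11 / 16 * (5 / 8) * (2 / 3) : ℝ) ≤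
          eulerProd q 1 (i + k) * eulerProd q (1 / ck q k) i * truncF q (i + k) (ck q k) := by
        gcongr
      linarith

lemma poch_mul_truncF_pow_pos {q : ℝ} (hq : 1 < q) {n i : ℕ} (hi : i ≤ n) :
    0 < poch q n * truncF q n (q ^ (i + 1)) := by
  obtain ⟨R, h, -, e⟩ := exists_truncF_mul_pow hq one_pos (by linarith) hq.le n i hi
  simp only [one_mul, sub_self, zero_mul, add_zero] at e
  rwa [e]

lemma continuous_truncF (q : ℝ) (n : ℕ) : Continuous (truncF q n) := by
  unfold truncF
  fun_prop

lemma exists_root_between {g : ℝ → ℝ} (hg : Continuous g) {a b : ℝ} (ha : 0 < g a)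
    (hb : g b < 0) : ∃ u, min a b < u ∧ u < max a b ∧ g u = 0 := by
  obtain ⟨u, hu, h0⟩ := intermediate_value_uIcc (a := a) (b := b) hg.continuousOn
    (show (0 : ℝ) ∈ Set.uIcc (g a) (g b) from
      ⟨(min_le_right _ _).trans hb.le, ha.le.trans (le_max_left _ _)⟩)
  have hua : u ≠ a := by rintro rfl; linarith
  have hub : u ≠ b := by rintro rfl; linarith
  refine ⟨u, lt_of_le_of_ne hu.1 ?_, lt_of_le_of_ne hu.2 ?_, h0⟩
  · rcases min_choice a b with h | h <;> rw [h] <;> exact Ne.symm ‹_›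
  · rcases max_choice a b with h | h <;> rw [h] <;> assumption

/-- Two strictly increasing enumerations of `n` roots of `F_{q,≤n}` coincide. -/
lemma eq_of_strictMono_of_truncF_eq_zero {q : ℝ} {n : ℕ} {r u : Fin n → ℝ}
    (hr : StrictMono r) (hu : StrictMono u) (hr0 : ∀ i, truncF q n (r i) = 0)
    (hu0 : ∀ i, truncF q n (u i) = 0) : r = u := by
  set p : Polynomial ℝ :=
    ∑ m ∈ Finset.range (n + 1), Polynomial.monomial m (poch q m)⁻¹ with hp
  have heval : ∀ x, p.eval x = truncF q n x := fun x => by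
    simp [hp, truncF, Polynomial.eval_finsetSum, div_eq_inv_mul]
  have hdeg : p.natDegree ≤ n := by
    refine Polynomial.natDegree_sum_le_of_forall_le _ _ fun m hm => ?_
    exact (Polynomial.natDegree_monomial_le _).trans (by simpa [Nat.lt_succ_iff] using hm)
  have hp0 : p ≠ 0 := by
    intro h
    have := heval 0
    rw [h, truncF, Finset.sum_range_succ'] at this
    simp [poch] at this
  have himg : ∀ v : Fin n → ℝ, StrictMono v → (∀ i, truncF q n (v i) = 0) →
      Finset.univ.image v = p.roots.toFinset := fun v hv hv0 => by
    refine Finset.eq_of_subset_of_card_le ?_ ?_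
    · intro x hx
      obtain ⟨i, -, rfl⟩ := Finset.mem_image.1 hx
      rw [Multiset.mem_toFinset, Polynomial.mem_roots hp0, Polynomial.IsRoot, heval, hv0]
    · rw [Finset.card_image_of_injective _ hv.injective, Finset.card_univ, Fintype.card_fin]
      exact (Multiset.toFinset_card_le _).trans ((Polynomial.card_roots' p).trans hdeg)
  refine (StrictMono.range_inj hr hu).1 ?_
  have := congrArg (fun s : Finset ℝ => (s : Set ℝ)) ((himg r hr hr0).trans (himg u hu hu0).symm)
  simpa using this

theorem stmt_12 (q : ℝ) (hq : 4 ≤ q) (n : ℕ) (hn : 1 ≤ n) (r : Fin n → ℝ)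
    (hmono : StrictMono r) (hpos : ∀ i, 0 < r i)
    (hroot : ∀ i, ∑ m ∈ Finset.range (n + 1), (r i) ^ m / poch q m = 0) :
    ∀ i : Fin n,
      min 1 (ck q (n - (i : ℕ))) < r i / q ^ ((i : ℕ) + 1) ∧
      r i / q ^ ((i : ℕ) + 1) < max 1 (ck q (n - (i : ℕ))) := by
  have hq0 : 0 < q := by linarith
  have hq1 : 1 < q := by linarith
  have hex : ∀ i : Fin n, ∃ u, min 1 (ck q (n - i)) < u ∧ u < max 1 (ck q (n - i)) ∧
      poch q n * truncF q n (u * q ^ ((i : ℕ) + 1)) = 0 := fun i => by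
    have hneg := poch_mul_truncF_ck_neg hq i (show 1 ≤ n - (i : ℕ) by omega)
    rw [Nat.add_sub_cancel' i.2.le] at hneg
    refine exists_root_between (g := fun u => poch q n * truncF q n (u * q ^ ((i : ℕ) + 1)))
      ?_ ?_ hneg
    · exact continuous_const.mul ((continuous_truncF q n).comp (by fun_prop))
    · simpa using poch_mul_truncF_pow_pos hq1 i.2.le
  choose u hlo hhi hz using hex
  have hu_lo : ∀ i, 1 / 2 < u i := fun i =>
    (le_min (by norm_num) (ck_bounds hq (by omega)).1).trans_lt (hlo i)
  have hu_hi : ∀ i, u i < 17 / 16 := fun i =>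
    (hhi i).trans_le (max_le (by norm_num) (ck_bounds hq (by omega)).2)
  have hsm : StrictMono fun i : Fin n => u i * q ^ ((i : ℕ) + 1) := fun i j hij => by
    have h1 : q ^ ((i : ℕ) + 1) * 4 ≤ q ^ ((j : ℕ) + 1) :=
      calc q ^ ((i : ℕ) + 1) * 4 ≤ q ^ ((i : ℕ) + 1) * q := by gcongr
        _ = q ^ ((i : ℕ) + 1 + 1) := (pow_succ _ _).symm
        _ ≤ q ^ ((j : ℕ) + 1) := pow_le_pow_right₀ hq1.le (by
          have : (i : ℕ) < j := hij
          omega)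
    have hp : 0 < q ^ ((i : ℕ) + 1) := by positivity
    have := hu_lo j
    have := hu_hi i
    simp only
    nlinarith
  have hr := eq_of_strictMono_of_truncF_eq_zero hmono hsm hroot fun i =>
    (mul_eq_zero.1 (hz i)).resolve_left (poch_ne_zero hq1 n)
  intro i
  rw [hr, mul_div_cancel_right₀ _ (by positivity)]
  exact ⟨hlo i, hhi i⟩
end

section
/- For q > 1 real and integers n ≥ 0, define G_{q,n}(t) = ∑_{ℓ=0}^∞ (−t)^ℓ (1;q)_{−ℓ−n−1} / q^{ℓ(ℓ−1)/2}, where (1;q)_{−m} = ∏_{j=1}^m (1 − q^{−j})^{−1}. Then for every integer m ≥ 1 and every real t with 0 < t < q − q^{−m−2}, the series for G_{q,m}(t) and G_{q,m+1}(t) converge and G_{q,m+1}(t) > G_{q,m}(t). -/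
/-- `(1;q)_{-m} = ∏_{j=1}^m (1 - q^{-j})^{-1}`. -/
noncomputable def pochInv (q : ℝ) (m : ℕ) : ℝ :=
  ∏ j ∈ Finset.range m, (1 - (q ^ (j + 1))⁻¹)⁻¹

/-- `G_{q,n}(t) = ∑_{ℓ=0}^∞ (-t)^ℓ (1;q)_{-ℓ-n-1} / q^{C(ℓ,2)}`. -/
noncomputable def G (q : ℝ) (n : ℕ) (t : ℝ) : ℝ :=
  ∑' ℓ : ℕ, (-t) ^ ℓ * pochInv q (ℓ + n + 1) / q ^ (ℓ * (ℓ - 1) / 2)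

theorem pochInv_succ (q : ℝ) (m : ℕ) :
    pochInv q (m + 1) = pochInv q m * (1 - (q ^ (m + 1))⁻¹)⁻¹ :=
  Finset.prod_range_succ _ _

theorem one_sub_inv_pow_succ_pos {q : ℝ} (hq : 1 < q) (k : ℕ) : 0 < 1 - (q ^ (k + 1))⁻¹ :=
  sub_pos.2 (inv_lt_one_of_one_lt₀ (one_lt_pow₀ hq k.succ_ne_zero))

theorem pochInv_pos {q : ℝ} (hq : 1 < q) (m : ℕ) : 0 < pochInv q m :=
  Finset.prod_pos fun j _ => inv_pos.2 (one_sub_inv_pow_succ_pos hq j)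

theorem pochInv_succ_sub {q : ℝ} (hq : 1 < q) (m : ℕ) :
    pochInv q (m + 1) - pochInv q m = pochInv q (m + 1) * (q ^ (m + 1))⁻¹ := by
  have h := (one_sub_inv_pow_succ_pos hq m).ne'
  have e : pochInv q m = pochInv q (m + 1) * (1 - (q ^ (m + 1))⁻¹) := by
    rw [pochInv_succ, mul_assoc, inv_mul_cancel₀ h, mul_one]
  rw [e]
  ring

theorem pow_triangle_succ (q : ℝ) (l : ℕ) :
    q ^ ((l + 1) * (l + 1 - 1) / 2) = q ^ (l * (l - 1) / 2) * q ^ l := by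
  rw [Nat.triangle_succ, pow_add]

/-- Consecutive coefficients of `G` satisfy a first-order recurrence. -/
theorem G_term_succ (q : ℝ) (n : ℕ) (x : ℝ) (l : ℕ) :
    x ^ (l + 1) * pochInv q (l + 1 + n + 1) / q ^ ((l + 1) * (l + 1 - 1) / 2) =
      x * (1 - (q ^ (l + n + 2))⁻¹)⁻¹ * (q ^ l)⁻¹ *
        (x ^ l * pochInv q (l + n + 1) / q ^ (l * (l - 1) / 2)) := by
  rw [pow_triangle_succ, show l + 1 + n + 1 = (l + n + 1) + 1 by ring, pochInv_succ,
    show l + n + 1 + 1 = l + n + 2 by ring, div_eq_mul_inv, div_eq_mul_inv, mul_inv, pow_succ]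
  ring

theorem summable_G_term {q : ℝ} (hq : 1 < q) (n : ℕ) {x : ℝ} (hx : x ≠ 0) :
    Summable (fun l : ℕ => x ^ l * pochInv q (l + n + 1) / q ^ (l * (l - 1) / 2)) := by
  have hq0 : 0 < q := zero_lt_one.trans hq
  have hne : ∀ l : ℕ, x ^ l * pochInv q (l + n + 1) / q ^ (l * (l - 1) / 2) ≠ 0 := fun l =>
    div_ne_zero (mul_ne_zero (pow_ne_zero _ hx) (pochInv_pos hq _).ne') (pow_pos hq0 _).ne'
  refine summable_of_ratio_test_tendsto_lt_one zero_lt_one (.of_forall hne) ?_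
  have hinv : Filter.Tendsto (fun l : ℕ => (q ^ l)⁻¹) Filter.atTop (nhds 0) :=
    (tendsto_pow_atTop_atTop_of_one_lt hq).inv_tendsto_atTop
  have hshift : Filter.Tendsto (fun l : ℕ => (q ^ (l + n + 2))⁻¹) Filter.atTop (nhds 0) :=
    hinv.comp (Filter.tendsto_add_atTop_nat (n + 2))
  have hlim := ((((hshift.const_sub 1).inv₀ (by norm_num)).const_mul x).mul hinv).norm
  rw [mul_zero, norm_zero] at hlim
  refine hlim.congr fun l => ?_
  rw [G_term_succ, norm_mul _ (x ^ l * _ / _),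
    mul_div_cancel_right₀ _ (norm_ne_zero_iff.2 (hne l))]

/-- `G` is positive wherever the first two terms of its alternating series decrease. -/
theorem G_pos {q : ℝ} (hq : 1 < q) (n : ℕ) {s : ℝ} (hs : 0 < s)
    (hs' : s < 1 - (q ^ (n + 2))⁻¹) : 0 < G q n s := by
  have hq0 : 0 < q := zero_lt_one.trans hq
  set f : ℕ → ℝ := fun l => s ^ l * pochInv q (l + n + 1) / q ^ (l * (l - 1) / 2) with hf
  have hfpos : ∀ l, 0 < f l := fun l =>
    div_pos (mul_pos (pow_pos hs _) (pochInv_pos hq _)) (pow_pos hq0 _)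
  have hlt : ∀ l, f (l + 1) < f l := by
    intro l
    have hpos := one_sub_inv_pow_succ_pos hq (l + n + 1)
    have hmono : (q ^ (l + n + 2))⁻¹ ≤ (q ^ (n + 2))⁻¹ :=
      inv_anti₀ (pow_pos hq0 _) (pow_le_pow_right₀ hq.le (by omega))
    have h1 : s * (1 - (q ^ (l + n + 2))⁻¹)⁻¹ < 1 := by
      rw [← div_eq_mul_inv, div_lt_one hpos]
      linarith
    have h2 : (q ^ l)⁻¹ ≤ 1 := inv_le_one_of_one_le₀ (one_le_pow₀ hq.le)
    have h3 : s * (1 - (q ^ (l + n + 2))⁻¹)⁻¹ * (q ^ l)⁻¹ < 1 :=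
      mul_lt_one_of_nonneg_of_lt_one_left (mul_pos hs (inv_pos.2 hpos)).le h1 h2
    calc f (l + 1) = s * (1 - (q ^ (l + n + 2))⁻¹)⁻¹ * (q ^ l)⁻¹ * f l := G_term_succ q n s l
      _ < f l := mul_lt_of_lt_one_left (hfpos l) h3
  have hsum := (summable_G_term hq n (neg_ne_zero.2 hs.ne')).hasSum.tendsto_sum_nat
  have hle := (antitone_nat_of_succ_le fun l => (hlt l).le).alternating_series_le_tendsto
    (l := G q n s) (hsum.congr fun N => Finset.sum_congr rfl fun l _ => by
      rw [hf, neg_pow]; ring) 1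
  have h01 := hlt 0
  simp only [mul_one, Finset.sum_range_succ, Finset.sum_range_zero, pow_zero, pow_one, one_mul,
    zero_add] at hle h01
  linarith

theorem G_succ_sub {q : ℝ} (hq : 1 < q) (n : ℕ) {t : ℝ} (ht : t ≠ 0) :
    G q (n + 1) t - G q n t = (q ^ (n + 2))⁻¹ * G q (n + 1) (t / q) := by
  have ht' := neg_ne_zero.2 ht
  rw [G, G, G, ← (summable_G_term hq (n + 1) ht').tsum_sub (summable_G_term hq n ht'),
    ← tsum_mul_left]
  refine tsum_congr fun l => ?_
  rw [← sub_div, ← mul_sub, show l + (n + 1) + 1 = l + n + 1 + 1 by ring, pochInv_succ_sub hq,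
    show l + n + 1 + 1 = l + (n + 2) by ring, pow_add q, mul_inv, ← neg_div, div_pow]
  ring

theorem stmt_16 (q : ℝ) (hq : 1 < q) (m : ℕ) (hm : 1 ≤ m) (t : ℝ)
    (ht : 0 < t) (ht2 : t < q - (q ^ (m + 2))⁻¹) :
    Summable (fun ℓ : ℕ => (-t) ^ ℓ * pochInv q (ℓ + m + 1) / q ^ (ℓ * (ℓ - 1) / 2)) ∧
    Summable (fun ℓ : ℕ => (-t) ^ ℓ * pochInv q (ℓ + (m + 1) + 1) / q ^ (ℓ * (ℓ - 1) / 2)) ∧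
    G q m t < G q (m + 1) t := by
  have hq0 : 0 < q := zero_lt_one.trans hq
  have ht' := neg_ne_zero.2 ht.ne'
  refine ⟨summable_G_term hq m ht', summable_G_term hq (m + 1) ht', sub_pos.1 ?_⟩
  rw [G_succ_sub hq m ht.ne']
  refine mul_pos (inv_pos.2 (pow_pos hq0 _)) (G_pos hq _ (div_pos ht hq0) ?_)
  rw [div_lt_iff₀ hq0, show m + 1 + 2 = m + 2 + 1 by ring, pow_succ, mul_inv, sub_mul, one_mul,
    inv_mul_cancel_right₀ hq0.ne']
  exact ht2
end

section
/- Let p ≥ 2 be an integer and set q = p². Let j ≥ 1 and k ≥ 1 be integers, define c₁ = 1 − 2q^{−1} and c_k = 1 + (−1)^k·4q^{−k(k+1)/2} for k > 1, and suppose r > 0 is a real number such that r·q^{−j} lies strictly between 1 and c_k. Then |p^{−j} − r^{−1/2}| < 2·p^{−(j+4k−2)}; equivalently, p^{−j}·|1 − c_k^{−1/2}| < 2·p^{−(j+4k−2)}. -/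
theorem abs_one_sub_inv_sqrt_lt {t y : ℝ} (hy : 0 < y) (hy1 : y < 1)
    (hlow : 1 < t * (1 + y) ^ 2) (hupp : t * (1 - y) ^ 2 < 1) :
    |1 - (Real.sqrt t)⁻¹| < y := by
  have ht : 0 < t := by
    by_contra! h
    nlinarith [mul_nonneg (neg_nonneg.2 h) (sq_nonneg (1 + y))]
  have hs : 0 < Real.sqrt t := Real.sqrt_pos.2 ht
  have hsq : Real.sqrt t ^ 2 = t := Real.sq_sqrt ht.le
  have hlow' : 1 < Real.sqrt t * (1 + y) := by
    refine lt_of_pow_lt_pow_left₀ 2 (by positivity) ?_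
    rw [mul_pow, hsq]
    simpa using hlow
  have hupp' : Real.sqrt t * (1 - y) < 1 := by
    refine lt_of_pow_lt_pow_left₀ 2 zero_le_one ?_
    rw [mul_pow, hsq]
    simpa using hupp
  have h1 : (Real.sqrt t)⁻¹ < 1 + y := (inv_lt_iff_one_lt_mul₀' hs).2 hlow'
  have h2 : 1 - y < (Real.sqrt t)⁻¹ := by
    rw [lt_inv_comm₀ (by linarith) hs, ← one_div, lt_div_iff₀ (by linarith)]
    exact hupp'
  rw [abs_lt]
  constructor <;> linarith

theorem ck_near_one {q : ℝ} (hq : 4 ≤ q) {k : ℕ} (hk : 1 ≤ k) :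
    (1 ≤ ck q k ∧ ck q k ≤ 1 + 2 * (2 / q ^ (2 * k - 1))) ∨
      (1 - 2 / q ^ (2 * k - 1) ≤ ck q k ∧ ck q k ≤ 1) := by
  have hq0 : 0 < q := by linarith
  rcases eq_or_lt_of_le hk with rfl | hk1
  · right
    have : 0 < 2 / q := by positivity
    simp [ck, this.le]
  rw [ck, if_neg hk1.ne']
  have hpos : 0 < 4 / q ^ (k * (k + 1) / 2) := by positivity
  rcases Nat.even_or_odd k with he | ho
  · left
    have hm : 2 * k - 1 ≤ k * (k + 1) / 2 := by
      rw [Nat.le_div_iff_mul_le two_pos]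
      obtain ⟨n, rfl⟩ := Nat.exists_eq_add_of_le hk1
      rw [show 2 * (Nat.succ 1 + n) - 1 = 2 * n + 3 by omega]
      simp only [Nat.succ_eq_add_one]
      nlinarith [Nat.zero_le n]
    have : 4 / q ^ (k * (k + 1) / 2) ≤ 4 / q ^ (2 * k - 1) := by
      gcongr
      linarith
    rw [he.neg_one_pow, one_mul]
    refine ⟨by linarith, ?_⟩
    calc _ ≤ 1 + 4 / q ^ (2 * k - 1) := by linarith
      _ = _ := by ring
  · right
    have hm : 2 * k - 1 + 1 ≤ k * (k + 1) / 2 := by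
      rw [Nat.le_div_iff_mul_le two_pos]
      have hk3 : 3 ≤ k := by
        obtain ⟨n, rfl⟩ := ho
        omega
      rw [Nat.sub_add_cancel (by omega)]
      nlinarith
    have : 4 / q ^ (k * (k + 1) / 2) ≤ 2 / q ^ (2 * k - 1) := by
      calc 4 / q ^ (k * (k + 1) / 2) ≤ 4 / q ^ (2 * k - 1 + 1) := by
            gcongr
            linarith
        _ ≤ 2 / q ^ (2 * k - 1) := by
            rw [pow_succ, div_le_div_iff₀ (by positivity) (by positivity)]
            nlinarith [pow_pos hq0 (2 * k - 1)]
    rw [ho.neg_one_pow, neg_one_mul, neg_div]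
    constructor <;> linarith

theorem stmt_18 (p : ℕ) (hp : 2 ≤ p) (j k : ℕ) (hj : 1 ≤ j) (hk : 1 ≤ k)
    (r : ℝ) (hr : 0 < r)
    (h1 : min 1 (ck ((p : ℝ) ^ 2) k) < r / ((p : ℝ) ^ 2) ^ j)
    (h2 : r / ((p : ℝ) ^ 2) ^ j < max 1 (ck ((p : ℝ) ^ 2) k)) :
    |((p : ℝ) ^ j)⁻¹ - (Real.sqrt r)⁻¹| < 2 / (p : ℝ) ^ (j + 4 * k - 2) ∧
    ((p : ℝ) ^ j)⁻¹ * |1 - (Real.sqrt (ck ((p : ℝ) ^ 2) k))⁻¹|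
      < 2 / (p : ℝ) ^ (j + 4 * k - 2) := by
  have hp2 : (2 : ℝ) ≤ p := by exact_mod_cast hp
  have hp0 : (0 : ℝ) < p := by linarith
  have hq : (4 : ℝ) ≤ (p : ℝ) ^ 2 := by nlinarith
  have hbound : 2 / (p : ℝ) ^ (j + 4 * k - 2)
      = ((p : ℝ) ^ j)⁻¹ * (2 / ((p : ℝ) ^ 2) ^ (2 * k - 1)) := by
    rw [show j + 4 * k - 2 = j + 2 * (2 * k - 1) by omega, pow_add, pow_mul]
    field_simp
  have hc := ck_near_one hq hk
  have hy : 0 < 2 / ((p : ℝ) ^ 2) ^ (2 * k - 1) := by positivity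
  have hy2 : 2 / ((p : ℝ) ^ 2) ^ (2 * k - 1) ≤ 1 / 2 := by
    have : (p : ℝ) ^ 2 ≤ ((p : ℝ) ^ 2) ^ (2 * k - 1) :=
      le_self_pow₀ (by linarith) (by omega)
    rw [div_le_div_iff₀ (by positivity) two_pos]
    linarith
  rw [hbound]
  generalize 2 / ((p : ℝ) ^ 2) ^ (2 * k - 1) = y at *
  generalize ck ((p : ℝ) ^ 2) k = c at *
  have key : ∀ t, min 1 c ≤ t → t ≤ max 1 c → |1 - (Real.sqrt t)⁻¹| < y := by
    intro t ht1 ht2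
    have ht : 1 - y ≤ t ∧ t ≤ 1 + 2 * y := by
      rcases hc with ⟨ha, hb⟩ | ⟨ha, hb⟩
      · rw [min_eq_left ha] at ht1
        rw [max_eq_right ha] at ht2
        constructor <;> linarith
      · rw [min_eq_right hb] at ht1
        rw [max_eq_left hb] at ht2
        constructor <;> linarith
    apply abs_one_sub_inv_sqrt_lt hy (by linarith)
    · calc 1 < (1 - y) * (1 + y) ^ 2 := by
            nlinarith [mul_pos hy (show 0 < 1 - y - y ^ 2 by nlinarith)]
        _ ≤ t * (1 + y) ^ 2 := by gcongr; exact ht.1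
    · calc t * (1 - y) ^ 2 ≤ (1 + 2 * y) * (1 - y) ^ 2 := by gcongr; exact ht.2
        _ < 1 := by nlinarith [mul_pos (mul_pos hy hy) (show 0 < 3 - 2 * y by linarith)]
  have hpj : 0 < ((p : ℝ) ^ j)⁻¹ := by positivity
  refine ⟨?_, mul_lt_mul_of_pos_left (key c (min_le_right _ _) (le_max_right _ _)) hpj⟩
  have hsqrt : Real.sqrt (r / ((p : ℝ) ^ 2) ^ j) = Real.sqrt r / (p : ℝ) ^ j := by
    rw [Real.sqrt_div hr.le, ← pow_mul, mul_comm 2 j, pow_mul,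
      Real.sqrt_sq (by positivity)]
  have hs := Real.sqrt_pos.2 hr
  have hfac : ((p : ℝ) ^ j)⁻¹ - (Real.sqrt r)⁻¹
      = ((p : ℝ) ^ j)⁻¹ * (1 - (Real.sqrt (r / ((p : ℝ) ^ 2) ^ j))⁻¹) := by
    rw [hsqrt]
    field_simp
  rw [hfac, abs_mul, abs_of_pos hpj]
  exact mul_lt_mul_of_pos_left (key _ h1.le h2.le) hpj
end

section
/- Let X₁ be uniform on {1, −1} and X₂ be uniform on {2, 0, −2}, independent, and set a₁ = (15 − 2√30)^{−1/2} and a₂ = (20 + 2√30)^{−1/2}. Then a₁ > a₂ > 0 and X̃ = a₁X₁ + a₂X₂ satisfies E[X̃^m] = E[Y^m] for all 1 ≤ m ≤ 4, where Y is uniform on [−1,1]. Similarly, if X₁ is uniform on {2, 0, −2} and X₂ is uniform on {1, −1}, independent, and a₁ = (20 − 2√30)^{−1/2}, a₂ = (15 + 2√30)^{−1/2}, then a₁ > a₂ > 0 and a₁X₁ + a₂X₂ matches the first 4 moments of Y uniform on [−1,1]. -/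
/-- If `x * X₁ + y * X₂`, with independent `X₁` uniform on `{1, -1}` and `X₂` uniform on
`{2, 0, -2}`, has the same second and fourth moments as the uniform law on `[-1, 1]`, then all its
moments of order one to four agree with those of that law. -/
theorem moment_eq_uniform_of_even_moments {x y : ℝ}
    (h2 : x ^ 2 + 8 / 3 * y ^ 2 = 1 / 3)
    (h4 : (x ^ 2) ^ 2 + 16 * (x ^ 2 * y ^ 2) + 32 / 3 * (y ^ 2) ^ 2 = 1 / 5)
    {m : ℕ} (hm1 : 1 ≤ m) (hm4 : m ≤ 4) :
    (1 / 6 : ℝ) *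
        ((x * 1 + y * 2) ^ m + (x * 1 + y * 0) ^ m + (x * 1 + y * (-2)) ^ m +
          (x * (-1) + y * 2) ^ m + (x * (-1) + y * 0) ^ m + (x * (-1) + y * (-2)) ^ m)
      = if Even m then 1 / ((m : ℝ) + 1) else 0 := by
  interval_cases m
  · rw [if_neg (by decide)]
    ring
  · rw [if_pos (by decide)]
    push_cast
    linear_combination h2
  · rw [if_neg (by decide)]
    ring
  · rw [if_pos (by decide)]
    push_cast
    linear_combination h4


theorem stmt_19 :
    (let a1 : ℝ := (Real.sqrt (15 - 2 * Real.sqrt 30))⁻¹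
     let a2 : ℝ := (Real.sqrt (20 + 2 * Real.sqrt 30))⁻¹
     a2 < a1 ∧ 0 < a2 ∧
      ∀ m : ℕ, 1 ≤ m → m ≤ 4 →
        (1 / 6 : ℝ) *
            ((a1 * 1 + a2 * 2) ^ m + (a1 * 1 + a2 * 0) ^ m + (a1 * 1 + a2 * (-2)) ^ m +
              (a1 * (-1) + a2 * 2) ^ m + (a1 * (-1) + a2 * 0) ^ m +
              (a1 * (-1) + a2 * (-2)) ^ m)
          = if Even m then 1 / ((m : ℝ) + 1) else 0) ∧
    (let a1 : ℝ := (Real.sqrt (20 - 2 * Real.sqrt 30))⁻¹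
     let a2 : ℝ := (Real.sqrt (15 + 2 * Real.sqrt 30))⁻¹
     a2 < a1 ∧ 0 < a2 ∧
      ∀ m : ℕ, 1 ≤ m → m ≤ 4 →
        (1 / 6 : ℝ) *
            ((a1 * 2 + a2 * 1) ^ m + (a1 * 0 + a2 * 1) ^ m + (a1 * (-2) + a2 * 1) ^ m +
              (a1 * 2 + a2 * (-1)) ^ m + (a1 * 0 + a2 * (-1)) ^ m +
              (a1 * (-2) + a2 * (-1)) ^ m)
          = if Even m then 1 / ((m : ℝ) + 1) else 0) := by
  have hs : Real.sqrt 30 ^ 2 = 30 := Real.sq_sqrt (by norm_num)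
  have hs0 : 0 ≤ Real.sqrt 30 := Real.sqrt_nonneg 30
  have hs6 : Real.sqrt 30 < 6 := by nlinarith
  set s := Real.sqrt 30
  have sq_inv_sqrt {t : ℝ} (ht : 0 < t) : (Real.sqrt t)⁻¹ ^ 2 = t⁻¹ := by
    rw [inv_pow, Real.sq_sqrt ht.le]
  have inv_sqrt_lt {t u : ℝ} (ht : 0 < t) (htu : t < u) : (Real.sqrt u)⁻¹ < (Real.sqrt t)⁻¹ :=
    inv_strictAnti₀ (Real.sqrt_pos.2 ht) (Real.sqrt_lt_sqrt ht.le htu)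
  have p1 : 0 < 15 - 2 * s := by linarith
  have p2 : 0 < 20 + 2 * s := by linarith
  have p3 : 0 < 20 - 2 * s := by linarith
  have p4 : 0 < 15 + 2 * s := by linarith
  have hs5 : 5 < s := by nlinarith
  have e1 : (15 - 2 * s)⁻¹ = (15 + 2 * s) / 105 :=
    inv_eq_of_mul_eq_one_right (by linear_combination (-4 / 105) * hs)
  have e2 : (20 + 2 * s)⁻¹ = (20 - 2 * s) / 280 :=
    inv_eq_of_mul_eq_one_right (by linear_combination (-4 / 280) * hs)
  have e3 : (20 - 2 * s)⁻¹ = (20 + 2 * s) / 280 :=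
    inv_eq_of_mul_eq_one_right (by linear_combination (-4 / 280) * hs)
  have e4 : (15 + 2 * s)⁻¹ = (15 - 2 * s) / 105 :=
    inv_eq_of_mul_eq_one_right (by linear_combination (-4 / 105) * hs)
  refine ⟨⟨inv_sqrt_lt p1 (by linarith), inv_pos.2 (Real.sqrt_pos.2 p2), fun m hm1 hm4 => ?_⟩,
    ⟨inv_sqrt_lt p3 (by linarith), inv_pos.2 (Real.sqrt_pos.2 p4), fun m hm1 hm4 => ?_⟩⟩
  · refine moment_eq_uniform_of_even_moments ?_ ?_ hm1 hm4
    · rw [sq_inv_sqrt p1, sq_inv_sqrt p2, e1, e2]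
      ring
    · rw [sq_inv_sqrt p1, sq_inv_sqrt p2, e1, e2]
      linear_combination (-14 / 11025) * hs
  · rw [← moment_eq_uniform_of_even_moments (x := (Real.sqrt (15 + 2 * s))⁻¹)
      (y := (Real.sqrt (20 - 2 * s))⁻¹) ?_ ?_ hm1 hm4]
    · ring
    · rw [sq_inv_sqrt p4, sq_inv_sqrt p3, e4, e3]
      ring
    · rw [sq_inv_sqrt p4, sq_inv_sqrt p3, e4, e3]
      linear_combination (-14 / 11025) * hs
end
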